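/- Suppose in addition that m·v = r + 1 for some integer v ≥ 1. Let 1 ≤ s ≤ r − v − 1 and 0 ≤ k ≤ r − v − 1 − s, and set t_i = m − ⌈m·(k+i+1)/r⌉ for 0 ≤ i ≤ s. Then for all integers j_0, j_1, …, j_s with 1 ≤ j_i ≤ t_i for each i, every permutation of the (s+1)-tuple (m·k + j_0, j_1, …, j_s) is an arithmetic pure gap at the indices (0, 1, …, s). -/

import Mathlib

open Finset

/-- Floor of the rational number `x / m`. -/
noncomputable def fdivq (m : ℕ) (x : ℤ) : ℤ := ⌊(x : ℚ) / (m : ℚ)⌋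

/-- The quantity `∑_{i=0}^{n-1} ⌊(a_i + t·λ_{c i})/m⌋ + ∑_{w ∉ range c} ⌊t·λ_w/m⌋`. -/
noncomputable def gapSum (m r n : ℕ) (lam : Fin (r + 1) → ℤ)
    (c : Fin n → Fin (r + 1)) (a : Fin n → ℤ) (t : ℤ) : ℤ :=
  (∑ i : Fin n, fdivq m (a i + t * lam (c i))) +
    ∑ w ∈ Finset.univ \ Finset.image c Finset.univ, fdivq m (t * lam w)

/-- `(a 0, …, a (n-1))` is an *arithmetic pure gap* at the (pairwise distinct) indices
`c 0, …, c (n-1)` of `{0,…,r}`: the entries are nonnegative and for every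
`t ∈ {0,…,m-1}` exactly one of the two Bartoli–Quoos–Zini conditions holds. -/
noncomputable def IsArithPureGap (m r n : ℕ) (lam : Fin (r + 1) → ℤ)
    (c : Fin n → Fin (r + 1)) (a : Fin n → ℤ) : Prop :=
  (∀ i, 0 ≤ a i) ∧
    ∀ t : ℤ, 0 ≤ t → t ≤ (m : ℤ) - 1 →
      Xor' (gapSum m r n lam c a t < 0)
        (0 ≤ gapSum m r n lam c a t ∧
          ∀ i : Fin n, fdivq m (a i + t * lam (c i)) = fdivq m (a i + t * lam (c i) - 1))

theorem fdivq_eq_ediv (m : ℕ) (x : ℤ) : fdivq m x = x / m :=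
  Rat.floor_intCast_div_natCast x m

theorem fdivq_eq_fdivq_sub_one {m : ℕ} (hm : 0 < m) {x : ℤ} (hx : ¬ (m : ℤ) ∣ x) :
    fdivq m x = fdivq m (x - 1) := by
  have hm' : (0 : ℤ) < m := by exact_mod_cast hm
  rw [fdivq_eq_ediv, fdivq_eq_ediv]
  have hpos : 0 < x % m :=
    lt_of_le_of_ne (Int.emod_nonneg x hm'.ne') fun h => hx (Int.dvd_of_emod_eq_zero h.symm)
  have hlt : x % m < m := Int.emod_lt_of_pos x hm'
  have hx' := Int.emod_add_mul_ediv x m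
  symm
  rw [Int.ediv_eq_iff_of_pos hm']
  constructor <;> nlinarith

/-- When `m * v = r + 1`, all multiplicities are congruent to `l` modulo `m`. -/
theorem mul_lam_eq {m r v : ℕ} (hmv : m * v = r + 1) {l : ℤ} {lam : Fin (r + 1) → ℤ}
    (hlam : ∀ i : Fin (r + 1), lam i = if i = 0 then -(r : ℤ) * l else l)
    (t : ℤ) (w : Fin (r + 1)) :
    t * lam w = t * l % m + m * (t * l / m - if w = 0 then v * (t * l) else 0) := by
  have hmv' : (m : ℤ) * v = r + 1 := by exact_mod_cast hmv
  have hdiv := Int.emod_add_mul_ediv (t * l) m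
  rw [hlam]
  split_ifs
  · linear_combination (t * l) * hmv' - hdiv
  · linear_combination -hdiv

theorem fdivq_add_mul_lam {m r v : ℕ} (hm : 0 < m) (hmv : m * v = r + 1) {l : ℤ}
    {lam : Fin (r + 1) → ℤ}
    (hlam : ∀ i : Fin (r + 1), lam i = if i = 0 then -(r : ℤ) * l else l)
    (a t : ℤ) (w : Fin (r + 1)) :
    fdivq m (a + t * lam w) =
      (a + t * l % m) / m + (t * l / m - if w = 0 then v * (t * l) else 0) := by
  rw [fdivq_eq_ediv, mul_lam_eq hmv hlam, ← add_assoc, Int.add_mul_ediv_left]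
  exact_mod_cast hm.ne'

/-- When `m * v = r + 1`, the sum depends only on the residue of `t * l` modulo `m`, and is
symmetric in the entries of the tuple. -/
theorem gapSum_eq {m r v n : ℕ} (hm : 0 < m) (hmv : m * v = r + 1) {l : ℤ}
    {lam : Fin (r + 1) → ℤ}
    (hlam : ∀ i : Fin (r + 1), lam i = if i = 0 then -(r : ℤ) * l else l)
    {c : Fin n → Fin (r + 1)} (hc : Function.Injective c) (a : Fin n → ℤ) (t : ℤ) :
    gapSum m r n lam c a t = ∑ i, (a i + t * l % m) / m - v * (t * l % m) := by
  have hm' : (0 : ℤ) < m := by exact_mod_cast hm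
  have hzero (w : Fin (r + 1)) :
      fdivq m (t * lam w) = t * l / m - if w = 0 then v * (t * l) else 0 := by
    have h := fdivq_add_mul_lam hm hmv hlam 0 t w
    rwa [zero_add, zero_add, Int.ediv_eq_zero_of_lt (Int.emod_nonneg _ hm'.ne')
      (Int.emod_lt_of_pos _ hm'), zero_add] at h
  have hsplit := Finset.sum_sdiff (Finset.subset_univ (Finset.image c Finset.univ))
    (f := fun w => t * l / m - if w = 0 then v * (t * l) else 0)
  rw [Finset.sum_image hc.injOn] at hsplit
  have htot : ∑ w : Fin (r + 1), (t * l / m - if w = 0 then v * (t * l) else 0) =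
      (r + 1) * (t * l / m) - v * (t * l) := by
    simp [Finset.sum_sub_distrib]
  have hmv' : (m : ℤ) * v = r + 1 := by exact_mod_cast hmv
  have hdiv := Int.emod_add_mul_ediv (t * l) m
  simp only [gapSum, fdivq_add_mul_lam hm hmv hlam, hzero, Finset.sum_add_distrib]
  linear_combination hsplit + htot - (t * l / m) * hmv' + v * hdiv

/-- If some index satisfies `p`, and `m * (k + i + 1) ≤ (m * v - 1) * ρ` for every such index `i`,
then `k` plus the number of such indices is less than `v * ρ`. -/
theorem add_card_filter_lt {n : ℕ} {p : Fin n → Prop} [DecidablePred p] {m k v ρ : ℤ}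
    (hm : 0 < m) (hρ : 0 < ρ) (hne : ∃ i, p i)
    (h : ∀ i, p i → m * (k + (i : ℕ) + 1) ≤ (m * v - 1) * ρ) :
    k + #{i | p i} < v * ρ := by
  obtain ⟨i₀, hi₀⟩ := hne
  have hS : ({i | p i} : Finset (Fin n)).Nonempty := ⟨i₀, by simpa using hi₀⟩
  set M := Finset.max' _ hS
  have hM : p M := by simpa using Finset.max'_mem _ hS
  have hcard : #{i | p i} ≤ (M : ℕ) + 1 := by
    rw [← Fin.card_Iic]
    exact Finset.card_le_card fun i hi => Finset.mem_Iic.2 (Finset.le_max' _ i hi)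
  have hcard' : (#{i | p i} : ℤ) ≤ (M : ℕ) + 1 := by exact_mod_cast hcard
  have := h M hM
  refine lt_of_mul_lt_mul_left (a := m) ?_ hm.le
  nlinarith

/-- A family of consecutive pure gaps at the indices `(0,1,…,s)` (including the
infinite place) in the case `m·v = r+1` (Proposition precisefamily2). -/
theorem consecutive_pureGaps_with_infinity (m r : ℕ) (hm : 2 ≤ m) (hr : 1 ≤ r)
    (l : ℤ) (hl : l ≠ 0) (hgcd : Int.gcd (m : ℤ) ((r : ℤ) * l) = 1)
    (lam : Fin (r + 1) → ℤ)
    (hlam : ∀ i : Fin (r + 1), lam i = if i = 0 then -(r : ℤ) * l else l)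
    (v : ℕ) (hv : 1 ≤ v) (hmv : m * v = r + 1)
    (s : ℕ) (hsr : s ≤ r) (hs1 : 1 ≤ s)
    (hs2 : (s : ℤ) ≤ (r : ℤ) - (v : ℤ) - 1)
    (k : ℕ) (hk : (k : ℤ) ≤ (r : ℤ) - (v : ℤ) - 1 - (s : ℤ))
    (jj : Fin (s + 1) → ℤ)
    (hjj : ∀ i : Fin (s + 1), 1 ≤ jj i ∧
      jj i ≤ (m : ℤ) - ⌈((m : ℚ) * ((k : ℚ) + ((i : ℕ) : ℚ) + 1)) / (r : ℚ)⌉)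
    (b : Fin (s + 1) → ℤ)
    (hb : ∀ i : Fin (s + 1), b i = if (i : ℕ) = 0 then (m : ℤ) * (k : ℤ) + jj i else jj i)
    (σ : Equiv.Perm (Fin (s + 1))) :
    IsArithPureGap m r (s + 1) lam
      (fun i => Fin.castLE (Nat.succ_le_succ hsr) i) (fun i => b (σ i)) := by
  have hm0 : 0 < m := by omega
  have hm' : (0 : ℤ) < m := by exact_mod_cast hm0
  have hr' : (0 : ℚ) < r := by exact_mod_cast hr
  have hmv' : (m : ℤ) * v = r + 1 := by exact_mod_cast hmv
  have hjlt (i : Fin (s + 1)) : jj i < m := by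
    have hpos : 0 < ⌈((m : ℚ) * ((k : ℚ) + ((i : ℕ) : ℚ) + 1)) / (r : ℚ)⌉ :=
      Int.ceil_pos.2 (by positivity)
    linarith [(hjj i).2]
  have hbound (i : Fin (s + 1)) (ρ : ℤ) (h : m ≤ jj i + ρ) :
      (m : ℤ) * (k + (i : ℕ) + 1) ≤ (m * v - 1) * ρ := by
    have hceil : ⌈((m : ℚ) * ((k : ℚ) + ((i : ℕ) : ℚ) + 1)) / (r : ℚ)⌉ ≤ ρ := by
      linarith [(hjj i).2]
    rw [Int.ceil_le, div_le_iff₀ hr'] at hceil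
    have hceil' : (m : ℤ) * (k + (i : ℕ) + 1) ≤ ρ * r := by exact_mod_cast hceil
    rw [hmv']
    linarith
  have hbj (i : Fin (s + 1)) : b i = jj i + m * if i = 0 then (k : ℤ) else 0 := by
    rw [hb]
    simp only [Fin.val_eq_zero_iff]
    split_ifs <;> ring
  refine ⟨fun i => ?_, fun t _ _ => ?_⟩
  · have := (hjj (σ i)).1
    simp only [hbj]
    split_ifs <;> positivity
  have hρ0 : 0 ≤ t * l % m := Int.emod_nonneg _ hm'.ne'
  have hρm : t * l % m < m := Int.emod_lt_of_pos _ hm'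
  have hfloor (i : Fin (s + 1)) : (b i + t * l % m) / m =
      (if m ≤ jj i + t * l % m then 1 else 0) + if i = 0 then (k : ℤ) else 0 := by
    rw [hbj, add_right_comm, Int.add_mul_ediv_left _ _ hm'.ne']
    congr 1
    have := (hjj i).1
    have := hjlt i
    rw [Int.ediv_eq_iff_of_pos hm']
    split_ifs <;> constructor <;> linarith
  have hsum := gapSum_eq hm0 hmv hlam
    (Fin.castLE_injective (Nat.succ_le_succ hsr)) (fun i => b (σ i)) t
  rw [Equiv.sum_comp σ fun i => (b i + t * l % m) / m] at hsum
  simp only [hfloor, Finset.sum_add_distrib, Finset.sum_boole, Finset.sum_ite_eq',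
    Finset.mem_univ, if_true] at hsum
  rcases lt_or_ge (gapSum m r (s + 1) lam
    (fun i => Fin.castLE (Nat.succ_le_succ hsr) i) (fun i => b (σ i)) t) 0 with hneg | hnonneg
  · exact Or.inl ⟨hneg, fun h => absurd h.1 hneg.not_ge⟩
  refine Or.inr ⟨⟨hnonneg, fun i => fdivq_eq_fdivq_sub_one hm0 fun hdvd => ?_⟩, hnonneg.not_gt⟩
  rw [mul_lam_eq hmv hlam, ← add_assoc, dvd_add_left (dvd_mul_right _ _)] at hdvd
  beta_reduce at hdvd
  rw [hbj, add_right_comm, dvd_add_left (dvd_mul_right _ _)] at hdvd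
  have hj1 := (hjj (σ i)).1
  have hle : m ≤ jj (σ i) + t * l % m := Int.le_of_dvd (by linarith) hdvd
  have hlt := add_card_filter_lt (k := k) hm' (by linarith [hjlt (σ i)]) ⟨σ i, hle⟩
    fun i hi => hbound i _ hi
  linarith
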